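/- Asymptotically almost surely, at most n^{2/3} colours of W do not appear among the colours of the first ⌈(n/2) log n⌉ edges e₁,…,e_{⌈(n/2) log n⌉} of the random digraph process; in particular, a.a.s. the first ⌈(n/2) log n⌉ edges carry at least n − 1 distinct colours, so m_C ≤ ⌈(n/2) log n⌉. -/

import Mathlib

open Filter

/-- The directed edges of the complete digraph on `Fin n`:
ordered pairs `(tail, head)` of distinct vertices. -/
abbrev DEdge (n : ℕ) := {e : Fin n × Fin n // e.1 ≠ e.2}

/-- `ε(n) = log log n / log n`. -/
noncomputable def eps (n : ℕ) : ℝ := Real.log (Real.log n) / Real.log n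

/-- The number of available colours: `⌊(1 + 50 ε) n⌋`. -/
noncomputable def numColours (n : ℕ) : ℕ := ⌊(1 + 50 * eps n) * n⌋₊

/-- The set of colours `W`. -/
abbrev Colour (n : ℕ) := Fin (numColours n)

/-- The sample space of the coloured random digraph process: a uniformly random
permutation of the edges (determining the random ordering `e₁, …, e_N`) together
with a uniformly random colouring of the edges. -/
abbrev SampleSpace (n : ℕ) := Equiv.Perm (DEdge n) × (DEdge n → Colour n)

/-- The (0-indexed) position of edge `e` in the random ordering determined by `ω`. -/
noncomputable def edgePos {n : ℕ} (ω : SampleSpace n) (e : DEdge n) : ℕ :=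
  ((Fintype.equivFin (DEdge n)) (ω.1 e)).val

/-- `e` is one of the first `m` edges of the process, i.e. an edge of `D(n,m)`. -/
def inProcess {n : ℕ} (ω : SampleSpace n) (m : ℕ) (e : DEdge n) : Prop :=
  edgePos ω e < m

/-- The probability of an event under the uniform measure on a finite sample space. -/
noncomputable def prob {Ω : Type*} [Fintype Ω] (p : Ω → Prop) : ℝ :=
  (Nat.card {ω : Ω // p ω} : ℝ) / (Fintype.card Ω : ℝ)

/-- Vertex `v` has in-degree zero in `D(n,m)`. -/
def InDegreeZero {n : ℕ} (ω : SampleSpace n) (m : ℕ) (v : Fin n) : Prop :=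
  ∀ e : DEdge n, inProcess ω m e → e.val.2 ≠ v

/-- The event `Z_m`: at most one vertex of `D(n,m)` has in-degree zero. -/
def ZEvent {n : ℕ} (ω : SampleSpace n) (m : ℕ) : Prop :=
  Set.Subsingleton {v : Fin n | InDegreeZero ω m v}

/-- `A` is the edge set of a spanning arborescence rooted at `u`: the root has no
in-edge, every other vertex has exactly one in-edge, and every vertex is reachable
from the root along edges of `A` (equivalently, for every vertex `v` there is
exactly one directed path from `u` to `v`). -/
def IsSpanningArborescence {n : ℕ} (A : Set (DEdge n)) (u : Fin n) : Prop :=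
  (∀ e ∈ A, (e : DEdge n).val.2 ≠ u) ∧
  (∀ v : Fin n, v ≠ u → ∃! e : DEdge n, e ∈ A ∧ e.val.2 = v) ∧
  (∀ v : Fin n, Relation.ReflTransGen (fun x y => ∃ e ∈ A, (e : DEdge n).val = (x, y)) u v)

/-- The event `A_m`: `D(n,m)` contains a spanning arborescence. -/
def AEvent {n : ℕ} (ω : SampleSpace n) (m : ℕ) : Prop :=
  ∃ (u : Fin n) (A : Set (DEdge n)), (∀ e ∈ A, inProcess ω m e) ∧ IsSpanningArborescence A u

/-- The event `R_m`: `D(n,m)` contains a rainbow spanning arborescence. -/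
def REvent {n : ℕ} (ω : SampleSpace n) (m : ℕ) : Prop :=
  ∃ (u : Fin n) (A : Set (DEdge n)), (∀ e ∈ A, inProcess ω m e) ∧
    IsSpanningArborescence A u ∧ Set.InjOn ω.2 A

/-- The hitting time `min {m : P m}`, with the convention `min ∅ = N = n(n-1)`. -/
noncomputable def hitTime (n : ℕ) (P : ℕ → Prop) : ℕ :=
  sInf ({m | P m} ∪ {n * (n - 1)})

/-- The event `C_m`: the first `m` edges carry at least `n - 1` distinct colours. -/
def CEvent {n : ℕ} (ω : SampleSpace n) (m : ℕ) : Prop :=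
  n - 1 ≤ {w : Colour n | ∃ e : DEdge n, inProcess ω m e ∧ ω.2 e = w}.ncard

/-- First moment bound: an event implied by `X ≤ t` has probability at least `1 - 𝔼 X / t`. -/
theorem one_sub_expectation_div_le_prob {Ω : Type*} [Fintype Ω] [Nonempty Ω] (X : Ω → ℕ)
    {t : ℝ} (ht : 0 < t) {p : Ω → Prop} (hp : ∀ ω, (X ω : ℝ) ≤ t → p ω) :
    1 - (∑ ω, (X ω : ℝ)) / Fintype.card Ω / t ≤ prob p := by
  classical
  have hcard : (0 : ℝ) < Fintype.card Ω := by exact_mod_cast Fintype.card_pos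
  have hmarkov : (Fintype.card Ω : ℝ) * t ≤ Nat.card {ω // p ω} * t + ∑ ω, (X ω : ℝ) := by
    calc (Fintype.card Ω : ℝ) * t = ∑ _ω : Ω, t := by simp
      _ ≤ ∑ ω : Ω, ((if p ω then t else 0) + X ω) := by
        refine Finset.sum_le_sum fun ω _ => ?_
        split_ifs with h
        · simp
        · have := mt (hp ω) h
          linarith
      _ = _ := by
        rw [Finset.sum_add_distrib, ← Finset.sum_filter, Finset.sum_const, nsmul_eq_mul,
          Nat.card_eq_fintype_card, Fintype.card_subtype]
  have hsplit : (Nat.card {ω // p ω} : ℝ) / Fintype.card Ω +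
      (∑ ω, (X ω : ℝ)) / Fintype.card Ω / t =
      (Nat.card {ω // p ω} * t + ∑ ω, (X ω : ℝ)) / (Fintype.card Ω * t) := by
    field_simp
  rw [prob, sub_le_iff_le_add, hsplit, one_le_div (mul_pos hcard ht)]
  exact hmarkov

theorem prob_le_one {Ω : Type*} [Fintype Ω] (p : Ω → Prop) : prob p ≤ 1 := by
  classical
  refine div_le_one_of_le₀ ?_ (Nat.cast_nonneg _)
  rw [Nat.card_eq_fintype_card]
  exact_mod_cast Fintype.card_subtype_le p

/-- The number of colourings for which the colour `w` does not appear on `S`. -/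
theorem card_colourings_avoiding {E C : Type*} [Fintype E] [DecidableEq E] [Fintype C]
    [DecidableEq C] (S : Finset E) (w : C) :
    (Finset.univ.filter fun c : E → C => ∀ e ∈ S, c e ≠ w).card =
      (Fintype.card C - 1) ^ S.card * Fintype.card C ^ (Fintype.card E - S.card) := by
  have h : (Finset.univ.filter fun c : E → C => ∀ e ∈ S, c e ≠ w) =
      Fintype.piFinset fun e => if e ∈ S then Finset.univ.erase w else Finset.univ := by
    ext c
    simp only [Finset.mem_filter, Finset.mem_univ, true_and, Fintype.mem_piFinset]
    refine forall_congr' fun e => ?_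
    by_cases he : e ∈ S <;> simp [he]
  rw [h, Fintype.card_piFinset]
  simp only [apply_ite Finset.card, Finset.card_erase_of_mem (Finset.mem_univ w),
    Finset.card_univ, Finset.prod_ite, Finset.prod_const]
  congr 2
  · simp
  · rw [Finset.filter_not, Finset.card_sdiff_of_subset (Finset.filter_subset _ _)]
    simp

theorem card_dEdge (n : ℕ) : Fintype.card (DEdge n) = n * (n - 1) := by
  have h : (Finset.univ.filter fun e : Fin n × Fin n => e.1 ≠ e.2) = Finset.univ.offDiag := by
    ext; simp
  rw [Fintype.card_subtype, h, Finset.offDiag_card]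
  simp [Nat.mul_sub]

open scoped Classical in
theorem card_inProcess {n m : ℕ} (hm : m ≤ n * (n - 1)) (ω : SampleSpace n) :
    (Finset.univ.filter fun e : DEdge n => inProcess ω m e).card = m := by
  rw [← card_dEdge] at hm
  have h : (Finset.univ.filter fun e : DEdge n => inProcess ω m e).map
      (ω.1.trans (Fintype.equivFin (DEdge n))).toEmbedding =
      Finset.univ.filter fun i : Fin (Fintype.card (DEdge n)) => i.val < m := by
    ext i
    simp only [Finset.mem_map_equiv, Finset.mem_filter, Finset.mem_univ, true_and]
    simp [inProcess, edgePos]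
  rw [← Finset.card_map, h, Fin.card_filter_val_lt, min_eq_right hm]

/-- The set of colours missing from the first `m` edges. -/
def missingColours {n : ℕ} (ω : SampleSpace n) (m : ℕ) : Set (Colour n) :=
  {w | ∀ e : DEdge n, inProcess ω m e → ω.2 e ≠ w}

theorem sum_ncard_missingColours {n m : ℕ} (hm : m ≤ n * (n - 1)) :
    ∑ ω : SampleSpace n, (missingColours ω m).ncard =
      Fintype.card (Equiv.Perm (DEdge n)) * (numColours n *
        ((numColours n - 1) ^ m * numColours n ^ (n * (n - 1) - m))) := by
  classical
  rw [Fintype.sum_prod_type, ← smul_eq_mul, ← Finset.card_univ, ← Finset.sum_const]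
  refine Finset.sum_congr rfl fun π _ => ?_
  have hncard (c : DEdge n → Colour n) : (missingColours (π, c) m).ncard =
      ∑ w : Colour n, if ∀ e : DEdge n, inProcess (π, c) m e → c e ≠ w then 1 else 0 := by
    rw [← Finset.card_filter, ← Set.ncard_coe_finset]
    simp [missingColours]
  simp_rw [hncard]
  rw [Finset.sum_comm]
  trans ∑ _w : Colour n, ((numColours n - 1) ^ m * numColours n ^ (n * (n - 1) - m))
  swap
  · simp
  refine Finset.sum_congr rfl fun w _ => ?_
  rw [← Finset.card_filter]
  by_cases hc : Nonempty (DEdge n → Colour n)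
  · obtain ⟨c₀⟩ := hc
    have h := card_colourings_avoiding
      (Finset.univ.filter fun e : DEdge n => inProcess (π, c₀) m e) w
    rw [card_inProcess hm, card_dEdge, Fintype.card_fin] at h
    rw [← h]
    congr 1
    ext c
    simp only [Finset.mem_filter, Finset.mem_univ, true_and]
    rfl
  · exact absurd ⟨fun _ => w⟩ hc

theorem expectation_missingColours_le {n m : ℕ} (hm : m ≤ n * (n - 1)) (hK : 0 < numColours n) :
    (∑ ω : SampleSpace n, ((missingColours ω m).ncard : ℝ)) / Fintype.card (SampleSpace n) ≤
      numColours n * Real.exp (-(m / numColours n)) := by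
  have hK' : (0 : ℝ) < numColours n := by exact_mod_cast hK
  have hP : (0 : ℝ) < Fintype.card (Equiv.Perm (DEdge n)) := by exact_mod_cast Fintype.card_pos
  rw [← Nat.cast_sum, sum_ncard_missingColours hm, Fintype.card_prod, Fintype.card_fun,
    card_dEdge, Fintype.card_fin]
  push_cast [Nat.cast_sub (Nat.one_le_iff_ne_zero.mpr hK.ne')]
  rw [mul_div_mul_left _ _ hP.ne', mul_div_assoc]
  refine mul_le_mul_of_nonneg_left ?_ hK'.le
  have hpow : (numColours n : ℝ) ^ (n * (n - 1)) =
      (numColours n : ℝ) ^ m * (numColours n : ℝ) ^ (n * (n - 1) - m) := by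
    rw [← pow_add, Nat.add_sub_cancel' hm]
  rw [hpow, mul_div_mul_right _ _ (pow_pos hK' _).ne', ← div_pow,
    show -((m : ℝ) / numColours n) = m * (-(1 / numColours n)) by ring, Real.exp_nat_mul]
  have h1 : (1 : ℝ) ≤ numColours n := by exact_mod_cast hK
  refine pow_le_pow_left₀ (div_nonneg (by linarith) hK'.le) ?_ _
  rw [sub_div, div_self hK'.ne']
  linarith [Real.add_one_le_exp (-(1 / (numColours n : ℝ)))]

theorem cEvent_of_ncard_missingColours_le {n m : ℕ} (ω : SampleSpace n)
    (h : n - 1 + (missingColours ω m).ncard ≤ numColours n) : CEvent ω m := by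
  have hcompl : {w : Colour n | ∃ e : DEdge n, inProcess ω m e ∧ ω.2 e = w} =
      (missingColours ω m)ᶜ := by
    ext w
    simp [missingColours]
  rw [CEvent, hcompl, Set.ncard_compl, Nat.card_eq_fintype_card, Fintype.card_fin]
  omega

theorem tendsto_eps : Tendsto eps atTop (nhds 0) :=
  (Real.isLittleO_log_id_atTop.tendsto_div_nhds_zero.comp
    (Real.tendsto_log_atTop.comp tendsto_natCast_atTop_atTop))

theorem eventually_numColours_le : ∀ᶠ n : ℕ in atTop, (numColours n : ℝ) ≤ 5 / 4 * n := by
  filter_upwards [tendsto_eps.eventually_le_const (show (0 : ℝ) < 1 / 200 by norm_num),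
    eventually_ge_atTop 1] with n hn h1
  rcases le_or_gt 0 ((1 + 50 * eps n) * n) with h | h
  · refine (Nat.floor_le h).trans ?_
    gcongr
    linarith
  · rw [numColours, Nat.floor_of_nonpos h.le, Nat.cast_zero]
    positivity

theorem eventually_le_numColours :
    ∀ᶠ n : ℕ in atTop, (n : ℝ) - 1 + (n : ℝ) ^ ((2 : ℝ) / 3) ≤ numColours n := by
  have hlog := Real.tendsto_log_atTop.comp (tendsto_natCast_atTop_atTop (R := ℝ))
  filter_upwards [(Real.tendsto_log_atTop.comp hlog).eventually_ge_atTop 1,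
    hlog.eventually_gt_atTop 0, eventually_ge_atTop 1,
    tendsto_natCast_atTop_atTop.eventually
      ((isLittleO_log_rpow_atTop (show (0 : ℝ) < 1 / 3 by norm_num)).bound one_pos)]
    with n hll hl hn hb
  simp only [Function.comp_apply] at hll hl
  have hn' : (0 : ℝ) < n := by exact_mod_cast hn
  rw [one_mul, Real.norm_of_nonneg hl.le, Real.norm_of_nonneg (by positivity)] at hb
  have hprod : (n : ℝ) ^ ((2 : ℝ) / 3) * (n : ℝ) ^ ((1 : ℝ) / 3) = n := by
    rw [← Real.rpow_add hn']
    norm_num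
  have heps : (n : ℝ) ^ ((2 : ℝ) / 3) ≤ eps n * n := by
    rw [eps, div_mul_eq_mul_div, le_div_iff₀ hl]
    calc (n : ℝ) ^ ((2 : ℝ) / 3) * Real.log n
        ≤ (n : ℝ) ^ ((2 : ℝ) / 3) * (n : ℝ) ^ ((1 : ℝ) / 3) := by gcongr
      _ = 1 * n := by rw [hprod, one_mul]
      _ ≤ _ := by gcongr
  have hpos : 0 ≤ (n : ℝ) ^ ((2 : ℝ) / 3) := by positivity
  have := Nat.sub_one_lt_floor ((1 + 50 * eps n) * (n : ℝ))
  rw [numColours]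
  linarith

theorem ceil_half_mul_log_le (n : ℕ) : ⌈(n : ℝ) / 2 * Real.log n⌉₊ ≤ n * (n - 1) := by
  rcases Nat.eq_zero_or_pos n with rfl | hn
  · simp
  have h1 : (1 : ℝ) ≤ n := by exact_mod_cast hn
  rw [Nat.ceil_le]
  push_cast [Nat.cast_sub hn]
  nlinarith [Real.log_le_sub_one_of_pos (show (0 : ℝ) < n by linarith), Real.log_nonneg h1]

/-- A.a.s. at most `n^{2/3}` colours are missing among the colours of
the first `⌈(n/2) log n⌉` edges of the process; in particular, a.a.s. these edges
carry at least `n - 1` distinct colours, so `m_C ≤ ⌈(n/2) log n⌉`. -/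
theorem aas_few_missing_colours :
    Tendsto
      (fun n : ℕ => prob (fun ω : SampleSpace n =>
        (({w : Colour n | ∀ e : DEdge n,
            inProcess ω ⌈(n : ℝ) / 2 * Real.log n⌉₊ e → ω.2 e ≠ w}.ncard : ℝ)
          ≤ (n : ℝ) ^ ((2 : ℝ) / 3)) ∧
        CEvent ω ⌈(n : ℝ) / 2 * Real.log n⌉₊ ∧
        hitTime n (CEvent ω) ≤ ⌈(n : ℝ) / 2 * Real.log n⌉₊))
      atTop (nhds 1) := by
  have hlim : Tendsto (fun n : ℕ => 1 - 5 / 4 * (n : ℝ) ^ (-((1 : ℝ) / 15))) atTop (nhds 1) := by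
    have h := ((tendsto_rpow_neg_atTop (show (0 : ℝ) < 1 / 15 by norm_num)).comp
      tendsto_natCast_atTop_atTop).const_mul (5 / 4 : ℝ)
    simpa using h.const_sub 1
  refine tendsto_of_tendsto_of_tendsto_of_le_of_le' hlim tendsto_const_nhds ?_
    (Eventually.of_forall fun n => prob_le_one _)
  filter_upwards [eventually_numColours_le, eventually_le_numColours, eventually_ge_atTop 1]
    with n hupper hlower hn
  set m := ⌈(n : ℝ) / 2 * Real.log n⌉₊
  have h1 : (1 : ℝ) ≤ n := by exact_mod_cast hn
  have hn0 : (0 : ℝ) < n := by linarith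
  have ht : 0 < (n : ℝ) ^ ((2 : ℝ) / 3) := by positivity
  have hK' : (0 : ℝ) < numColours n := by linarith
  have hK : 0 < numColours n := by exact_mod_cast hK'
  have : Nonempty (Colour n) := ⟨⟨0, hK⟩⟩
  have hexp : Real.exp (-(m / numColours n)) ≤ (n : ℝ) ^ (-((2 : ℝ) / 5)) := by
    rw [Real.rpow_def_of_pos hn0, Real.exp_le_exp, mul_neg, neg_le_neg_iff, le_div_iff₀ hK']
    have hlog := Real.log_nonneg h1
    calc Real.log n * (2 / 5) * numColours n ≤ Real.log n * (2 / 5) * (5 / 4 * n) := by gcongr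
      _ = n / 2 * Real.log n := by ring
      _ ≤ m := Nat.le_ceil _
  have hpow : (n : ℝ) * (n : ℝ) ^ (-((2 : ℝ) / 5)) / (n : ℝ) ^ ((2 : ℝ) / 3) =
      (n : ℝ) ^ (-((1 : ℝ) / 15)) := by
    rw [← Real.rpow_one_add' hn0.le (by norm_num), ← Real.rpow_sub hn0]
    norm_num
  have hE : (∑ ω : SampleSpace n, ((missingColours ω m).ncard : ℝ)) /
      Fintype.card (SampleSpace n) / (n : ℝ) ^ ((2 : ℝ) / 3) ≤
        5 / 4 * (n : ℝ) ^ (-((1 : ℝ) / 15)) := by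
    rw [← hpow, ← mul_div_assoc, ← mul_assoc]
    gcongr
    exact (expectation_missingColours_le (ceil_half_mul_log_le n) hK).trans (by gcongr)
  refine (sub_le_sub_left hE 1).trans
    (one_sub_expectation_div_le_prob (fun ω => (missingColours ω m).ncard) ht fun ω hω => ?_)
  have hC : CEvent ω m := by
    refine cEvent_of_ncard_missingColours_le ω ?_
    have : ((n - 1 + (missingColours ω m).ncard : ℕ) : ℝ) ≤ numColours n := by
      push_cast [Nat.cast_sub hn]
      linarith
    exact_mod_cast this
  exact ⟨hω, hC, Nat.sInf_le (Or.inl hC)⟩
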